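/- If G is a finite 2-connected outerplanar graph with Δ(G) ≥ 5 and girth g(G) ≥ 4, then χ_{vi,1}(G) = Δ(G) + 2. -/

import Mathlib

open SimpleGraph

variable {V : Type*}

/-- `(v, e)` is an incidence of `G`: `e` is an edge of `G` and `v ∈ e`. -/
def SimpleGraph.IsIncidence (G : SimpleGraph V) (v : V) (e : Sym2 V) : Prop :=
  e ∈ G.edgeSet ∧ v ∈ e

/-- A vi-simultaneous proper `k`-coloring of `G`, given by a coloring `cV` of the vertices
and a coloring `cI` of the incidences (the value of `cI v e` matters only when `(v, e)` is
an incidence of `G`). -/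
structure SimpleGraph.IsViColoring (G : SimpleGraph V) (k : ℕ)
    (cV : V → Fin k) (cI : V → Sym2 V → Fin k) : Prop where
  /-- adjacent vertices receive distinct colors -/
  adj_ne : ∀ ⦃u v⦄, G.Adj u v → cV u ≠ cV v
  /-- a vertex `u` and an incidence `(w, f)` with `u ∈ f` receive distinct colors -/
  vertex_inc_ne : ∀ ⦃u w f⦄, G.IsIncidence w f → u ∈ f → cV u ≠ cI w f
  /-- two distinct incidences `(v, e)` and `(w, f)` receive distinct colors whenever
  `v = w`, or `e = f`, or the edge `{v, w}` equals `e` or `f` -/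
  inc_ne : ∀ ⦃v e w f⦄, G.IsIncidence v e → G.IsIncidence w f → (v, e) ≠ (w, f) →
    (v = w ∨ e = f ∨ s(v, w) = e ∨ s(v, w) = f) → cI v e ≠ cI w f

/-- The set of colors appearing on the second incidences
`I_2(u) = {(v, {u, v}) : v adjacent to u}` of a vertex `u`. -/
def SimpleGraph.secondIncColors (G : SimpleGraph V) {k : ℕ}
    (cI : V → Sym2 V → Fin k) (u : V) : Set (Fin k) :=
  {a | ∃ v, G.Adj u v ∧ cI v s(u, v) = a}

/-- The vi-simultaneous chromatic number `χ_vi(G)`. -/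
noncomputable def SimpleGraph.chiVi (G : SimpleGraph V) : ℕ :=
  sInf {k | ∃ cV cI, G.IsViColoring k cV cI}

/-- `χ_{vi,s}(G)`: the least `k` admitting a vi-simultaneous `(k, s)`-coloring, i.e. a
vi-simultaneous proper `k`-coloring using at most `s` colors on `I_2(v)` for each vertex `v`. -/
noncomputable def SimpleGraph.chiViS (G : SimpleGraph V) (s : ℕ) : ℕ :=
  sInf {k | ∃ cV cI, G.IsViColoring k cV cI ∧
    ∀ u, (G.secondIncColors cI u).ncard ≤ s}

/-- `G` is outerplanar: there is a linear ordering of the vertices such that no two edges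
`{a, b}` and `{c, d}` satisfy `a < c < b < d`. -/
def SimpleGraph.Outerplanar (G : SimpleGraph V) : Prop :=
  ∃ r : LinearOrder V, ∀ a b c d : V, G.Adj a b → G.Adj c d →
    ¬(r.lt a c ∧ r.lt c b ∧ r.lt b d)

/-- The maximum degree `Δ(G)` of a finite graph. -/
noncomputable def SimpleGraph.maxDeg (G : SimpleGraph V) [Fintype V] : ℕ :=
  Finset.univ.sup fun v => (G.neighborSet v).ncard

/-- `G` is 2-connected: it has at least 3 vertices, is connected, and deleting any single
vertex leaves it connected. -/
def SimpleGraph.TwoConnected (G : SimpleGraph V) [Fintype V] : Prop :=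
  3 ≤ Fintype.card V ∧ G.Connected ∧
    ∀ v : V, (((⊤ : G.Subgraph).deleteVerts {v}).coe).Connected

namespace SimpleGraph

/-- `b` colors the vertices in `B` and `c` those in `C` in such a way that `b` is proper on the
square of `G`, `c` is proper on `G`, and `c u` is never one of the values of `b` on the closed
neighborhood of `u`. If `B` and `C` are everything, giving each incidence `(v, {v, w})` the color
`b w` turns this into a vi-simultaneous `(k, 1)`-coloring. -/
structure IsPairColoring {k : ℕ} (G : SimpleGraph V) (B C : Set V) (b c : V → Fin k) : Prop where
  sq_ne : ∀ u ∈ B, ∀ w ∈ B, u ≠ w → (G.Adj u w ∨ ∃ m, G.Adj u m ∧ G.Adj m w) → b u ≠ b w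
  adj_ne : ∀ u ∈ C, ∀ w ∈ C, G.Adj u w → c u ≠ c w
  closed_ne : ∀ u ∈ C, ∀ w ∈ B, u = w ∨ G.Adj u w → c u ≠ b w

theorem exists_fin_notMem {k : ℕ} {F : Finset (Fin k)} (hF : F.card < k) : ∃ a, a ∉ F := by
  by_contra! h
  have : F = Finset.univ := Finset.eq_univ_of_forall h
  simp [this] at hF

theorem IsPairColoring.exists_insert_left {k : ℕ} {G : SimpleGraph V} {B C : Set V}
    {b c : V → Fin k} (h : G.IsPairColoring B C b c) (x : V) (F : Finset (Fin k))
    (hF : F.card < k)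
    (hb : ∀ w ∈ B, w ≠ x → (G.Adj x w ∨ ∃ m, G.Adj x m ∧ G.Adj m w) → b w ∈ F)
    (hc : ∀ u ∈ C, u = x ∨ G.Adj x u → c u ∈ F) :
    ∃ b' : V → Fin k, G.IsPairColoring (insert x B) C b' c := by
  classical
  obtain ⟨a, ha⟩ := exists_fin_notMem hF
  refine ⟨Function.update b x a, ?_, h.adj_ne, ?_⟩
  · intro u hu w hw huw hd
    have hd' : G.Adj w u ∨ ∃ m, G.Adj w m ∧ G.Adj m u :=
      hd.imp (·.symm) fun ⟨m, h1, h2⟩ => ⟨m, h2.symm, h1.symm⟩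
    by_cases hux : u = x
    · subst hux
      have hwB : w ∈ B := hw.resolve_left (Ne.symm huw)
      have := hb w hwB (Ne.symm huw) hd
      rw [Function.update_self, Function.update_of_ne (Ne.symm huw)]
      rintro rfl
      exact ha this
    · have huB : u ∈ B := hu.resolve_left hux
      by_cases hwx : w = x
      · subst hwx
        have := hb u huB huw hd'
        rw [Function.update_self, Function.update_of_ne huw]
        rintro rfl
        exact ha this
      · rw [Function.update_of_ne hux, Function.update_of_ne hwx]
        exact h.sq_ne u huB w (hw.resolve_left hwx) huw hd
  · intro u hu w hw huw
    by_cases hwx : w = x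
    · subst hwx
      have := hc u hu (huw.imp id (·.symm))
      rw [Function.update_self]
      rintro rfl
      exact ha this
    · rw [Function.update_of_ne hwx]
      exact h.closed_ne u hu w (hw.resolve_left hwx) huw

theorem IsPairColoring.exists_insert_right {k : ℕ} {G : SimpleGraph V} {B C : Set V}
    {b c : V → Fin k} (h : G.IsPairColoring B C b c) (x : V) (F : Finset (Fin k))
    (hF : F.card < k) (hb : ∀ w ∈ B, w = x ∨ G.Adj x w → b w ∈ F)
    (hc : ∀ u ∈ C, G.Adj x u → c u ∈ F) :
    ∃ c' : V → Fin k, G.IsPairColoring B (insert x C) b c' := by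
  classical
  obtain ⟨a, ha⟩ := exists_fin_notMem hF
  refine ⟨Function.update c x a, h.sq_ne, ?_, ?_⟩
  · intro u hu w hw huw
    have hne := huw.ne
    by_cases hux : u = x
    · subst hux
      have := hc w (hw.resolve_left hne.symm) huw
      rw [Function.update_self, Function.update_of_ne hne.symm]
      rintro rfl
      exact ha this
    · by_cases hwx : w = x
      · subst hwx
        have := hc u (hu.resolve_left hux) huw.symm
        rw [Function.update_self, Function.update_of_ne hne]
        rintro rfl
        exact ha this
      · rw [Function.update_of_ne hux, Function.update_of_ne hwx]
        exact h.adj_ne u (hu.resolve_left hux) w (hw.resolve_left hwx) huw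
  · intro u hu w hw huw
    by_cases hux : u = x
    · subst hux
      have := hb w hw (huw.imp Eq.symm id)
      rw [Function.update_self]
      rintro rfl
      exact ha this
    · rw [Function.update_of_ne hux]
      exact h.closed_ne u (hu.resolve_left hux) w hw huw

/-- The colors forbidden at `x` by its neighbor `v`. -/
theorem exists_forbidden [Finite V] {k : ℕ} {G : SimpleGraph V} {v x : V} (hvx : G.Adj v x)
    (b c : V → Fin k) :
    ∃ F : Finset (Fin k), F.card ≤ (G.neighborSet v).ncard + 1 ∧ c v ∈ F ∧ b v ∈ F ∧
      ∀ w, G.Adj v w → w ≠ x → b w ∈ F := by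
  classical
  have := Fintype.ofFinite V
  refine ⟨insert (c v) (insert (b v) ((G.neighborFinset v \ {x}).image b)), ?_, by simp,
    by simp, fun w hw hwx => ?_⟩
  · have h1 : (G.neighborFinset v \ {x}).card + 1 = (G.neighborSet v).ncard := by
      rw [Finset.sdiff_singleton_eq_erase, Finset.card_erase_add_one (by simpa using hvx),
        Set.ncard_eq_toFinset_card']
      rfl
    have h2 := Finset.card_insert_le (c v) (insert (b v) ((G.neighborFinset v \ {x}).image b))
    have h3 := Finset.card_insert_le (b v) ((G.neighborFinset v \ {x}).image b)
    have h4 := Finset.card_image_le (s := G.neighborFinset v \ {x}) (f := b)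
    omega
  · exact Finset.mem_insert_of_mem (Finset.mem_insert_of_mem
      (Finset.mem_image_of_mem b (by simp [hw, hwx])))

theorem IsPairColoring.extend_vertex [Finite V] {k : ℕ} {G : SimpleGraph V} {b c : V → Fin k}
    {x : V} (h : G.IsPairColoring {x}ᶜ {x}ᶜ b c) (hk : 7 ≤ k)
    (hdeg : ∀ v, (G.neighborSet v).ncard + 2 ≤ k) (hx : (G.neighborSet x).ncard ≤ 1) :
    ∃ b c : V → Fin k, G.IsPairColoring Set.univ Set.univ b c := by
  have huniv : insert x ({x}ᶜ : Set V) = Set.univ := by ext; simp [em]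
  rw [Set.ncard_le_one] at hx
  simp only [mem_neighborSet] at hx
  by_cases hv : ∃ v, G.Adj x v
  · obtain ⟨v, hv⟩ := hv
    obtain ⟨F, hF, hcv, hbv, hbw⟩ := exists_forbidden hv.symm b c
    obtain ⟨b', h⟩ := h.exists_insert_left x F (by have := hdeg v; omega) (by grind) (by grind)
    obtain ⟨c', h⟩ := h.exists_insert_right x {b' x, b' v, c v}
      (by have := Finset.card_le_three (a := b' x) (b := b' v) (c := c v); omega)
      (by grind) (by grind)
    exact ⟨b', c', by simpa only [huniv] using h⟩
  · obtain ⟨b', h⟩ := h.exists_insert_left x ∅ (by simp; omega) (by grind) (by grind)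
    obtain ⟨c', h⟩ := h.exists_insert_right x {b' x} (by simp; omega) (by grind) (by grind)
    exact ⟨b', c', by simpa only [huniv] using h⟩

theorem IsPairColoring.extend_edge [Finite V] {k : ℕ} {G : SimpleGraph V} {b c : V → Fin k}
    {u x y v : V} (h : G.IsPairColoring {x, y}ᶜ {x, y}ᶜ b c) (hk : 7 ≤ k)
    (hdeg : ∀ v, (G.neighborSet v).ncard + 2 ≤ k) (hu : (G.neighborSet u).ncard ≤ 4)
    (huv : G.Adj u v) (hx : ∀ w, G.Adj x w ↔ w = u ∨ w = y)
    (hy : ∀ w, G.Adj y w ↔ w = x ∨ w = v) :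
    ∃ b c : V → Fin k, G.IsPairColoring Set.univ Set.univ b c := by
  have huniv : insert x (insert y ({x, y}ᶜ : Set V)) = Set.univ := by ext; simp; tauto
  have hux : G.Adj u x := ((hx u).2 (Or.inl rfl)).symm
  have hvy : G.Adj v y := ((hy v).2 (Or.inr rfl)).symm
  obtain ⟨F, hF, hcv, hbv, hbw⟩ := exists_forbidden hvy b c
  have huv' := huv.symm
  obtain ⟨b, h⟩ := h.exists_insert_left y F (by have := hdeg v; omega) (by grind) (by grind)
  obtain ⟨F, hF, hcu, hbu, hbw⟩ := exists_forbidden hux b c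
  obtain ⟨b, h⟩ := h.exists_insert_left x (insert (b y) F)
    (by have := Finset.card_insert_le (b y) F; omega) (by grind) (by grind)
  obtain ⟨c, h⟩ := h.exists_insert_right y {c v, b v, b y, b x}
    (Finset.card_le_four.trans_lt (by omega)) (by grind) (by grind)
  obtain ⟨c, h⟩ := h.exists_insert_right x {c u, c y, b u, b y, b x}
    (Finset.card_le_five.trans_lt (by omega)) (by grind) (by grind)
  exact ⟨b, c, by simpa only [huniv] using h⟩

theorem IsPairColoring.extend_path [Finite V] {k : ℕ} {G : SimpleGraph V} {b c : V → Fin k}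
    {u x y z v : V} (h : G.IsPairColoring {x, y, z}ᶜ {x, y, z}ᶜ b c) (hk : 7 ≤ k)
    (hdeg : ∀ v, (G.neighborSet v).ncard + 2 ≤ k) (hu : (G.neighborSet u).ncard ≤ 4)
    (hx : ∀ w, G.Adj x w ↔ w = u ∨ w = y) (hy : ∀ w, G.Adj y w ↔ w = x ∨ w = z)
    (hz : ∀ w, G.Adj z w ↔ w = y ∨ w = v) :
    ∃ b c : V → Fin k, G.IsPairColoring Set.univ Set.univ b c := by
  have hux : G.Adj u x := ((hx u).2 (Or.inl rfl)).symm
  have hvz : G.Adj v z := ((hz v).2 (Or.inr rfl)).symm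
  have hxy : x ≠ y := ((hx y).2 (Or.inr rfl)).ne
  obtain ⟨F, hF, hcv, hbv, hbw⟩ := exists_forbidden hvz b c
  obtain ⟨b, h⟩ := h.exists_insert_left z F (by have := hdeg v; omega) (by grind) (by grind)
  obtain ⟨F, hF, hcu, hbu, hbw⟩ := exists_forbidden hux b c
  obtain ⟨b, h⟩ := h.exists_insert_left x (insert (b z) F)
    (by have := Finset.card_insert_le (b z) F; omega) (by grind) (by grind)
  obtain ⟨b, h⟩ := h.exists_insert_left y {b x, b z, b u, b v}
    (Finset.card_le_four.trans_lt (by omega)) (by grind) (by grind)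
  obtain ⟨c, h⟩ := h.exists_insert_right x {c u, b u, b y, b x}
    (Finset.card_le_four.trans_lt (by omega)) (by grind) (by grind)
  obtain ⟨c, h⟩ := h.exists_insert_right z {c v, b v, b y, b z}
    (Finset.card_le_four.trans_lt (by omega)) (by grind) (by grind)
  obtain ⟨c, h⟩ := h.exists_insert_right y {c x, c z, b x, b y, b z}
    (Finset.card_le_five.trans_lt (by omega)) (by grind) (by grind)
  have hB : insert y (insert x (insert z ({x, y, z}ᶜ : Set V))) = Set.univ := by
    ext; simp; tauto
  have hC : insert y (insert z (insert x ({x, y, z}ᶜ : Set V))) = Set.univ := by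
    ext; simp; tauto
  exact ⟨b, c, by simpa only [hB, hC] using h⟩

section Structure

variable [LinearOrder V] {G : SimpleGraph V}

/-- `{a, b}` is an edge with `a < b` such that some vertex lies strictly between `a` and `b`. -/
def IsChord (G : SimpleGraph V) (a b : V) : Prop :=
  G.Adj a b ∧ ∃ z, a < z ∧ z < b

/-- A chord whose interval contains no other chord. -/
def IsMinChord (G : SimpleGraph V) (a b : V) : Prop :=
  G.IsChord a b ∧ ∀ c d, G.IsChord c d → a ≤ c → d ≤ b → c = a ∧ d = b

theorem exists_lt_lt_of_two_lt_ncard [Finite V] {S : Set V} (h : 2 < S.ncard) :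
    ∃ p ∈ S, ∃ q ∈ S, ∃ r ∈ S, p < q ∧ q < r := by
  obtain ⟨a, ha, b, hb, c, hc, hab, hac, hbc⟩ := (Set.two_lt_ncard).1 h
  rcases lt_or_gt_of_ne hab with h1 | h1 <;> rcases lt_or_gt_of_ne hac with h2 | h2 <;>
    rcases lt_or_gt_of_ne hbc with h3 | h3 <;> grind

theorem ncard_neighborSet_le_four [Finite V] {x : V}
    (hr : ∀ y, G.IsChord x y → G.IsMinChord x y) (hl : ∀ y, G.IsChord y x → G.IsMinChord y x) :
    (G.neighborSet x).ncard ≤ 4 := by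
  have h1 : (G.neighborSet x ∩ Set.Ioi x).ncard ≤ 2 := by
    by_contra! h
    obtain ⟨p, ⟨hp, hxp⟩, q, ⟨hq, hxq⟩, r, ⟨hr', hxr⟩, hpq, hqr⟩ := exists_lt_lt_of_two_lt_ncard h
    exact hqr.ne ((hr r ⟨hr', q, hxq, hqr⟩).2 x q ⟨hq, p, hxp, hpq⟩ le_rfl hqr.le).2
  have h2 : (G.neighborSet x ∩ Set.Iio x).ncard ≤ 2 := by
    by_contra! h
    obtain ⟨p, ⟨hp, hpx⟩, q, ⟨hq, hqx⟩, r, ⟨hr', hrx⟩, hpq, hqr⟩ := exists_lt_lt_of_two_lt_ncard h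
    exact hpq.ne' ((hl p ⟨hp.symm, q, hpq, hqx⟩).2 q x ⟨hq.symm, r, hqr, hrx⟩ hpq.le le_rfl).1
  have h3 : G.neighborSet x ⊆ (G.neighborSet x ∩ Set.Ioi x) ∪ (G.neighborSet x ∩ Set.Iio x) := by
    intro y hy
    rcases lt_or_gt_of_ne (G.ne_of_adj hy) with h | h
    · exact Or.inl ⟨hy, h⟩
    · exact Or.inr ⟨hy, h⟩
  have h4 := Set.ncard_le_ncard h3
  have h5 := Set.ncard_union_le (G.neighborSet x ∩ Set.Ioi x) (G.neighborSet x ∩ Set.Iio x)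
  omega

theorem exists_isChord [Finite V] [Nonempty V] (hdeg : ∀ v, 2 ≤ (G.neighborSet v).ncard) :
    ∃ a b, G.IsChord a b := by
  obtain ⟨a, ha⟩ := Finite.exists_min (id : V → V)
  obtain ⟨p, hp, q, hq, hpq⟩ := (Set.one_lt_ncard).1 (hdeg a)
  have hap : a < p := lt_of_le_of_ne (ha p) (G.ne_of_adj hp)
  have haq : a < q := lt_of_le_of_ne (ha q) (G.ne_of_adj hq)
  rcases lt_or_gt_of_ne hpq with h | h
  · exact ⟨a, q, hq, p, hap, h⟩
  · exact ⟨a, p, hp, q, haq, h⟩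

theorem IsChord.ncard_Icc_lt [Finite V] {a b c d : V} (h : G.IsChord c d) (hac : a ≤ c)
    (hdb : d ≤ b) (hne : ¬(c = a ∧ d = b)) : (Set.Icc c d).ncard < (Set.Icc a b).ncard := by
  obtain ⟨-, z, hcz, hzd⟩ := h
  refine Set.ncard_lt_ncard ⟨Set.Icc_subset_Icc hac hdb, fun hsub => hne ?_⟩
  have h1 := (hsub (Set.left_mem_Icc.2 (hac.trans ((hcz.trans hzd).le.trans hdb)))).1
  have h2 := (hsub (Set.right_mem_Icc.2 (hac.trans ((hcz.trans hzd).le.trans hdb)))).2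
  exact ⟨le_antisymm h1 hac, le_antisymm hdb h2⟩

theorem IsChord.exists_minimal [Finite V] (P : V → V → Prop) (hP : ∃ a b, P a b ∧ G.IsChord a b) :
    ∃ a b, P a b ∧ G.IsChord a b ∧
      ∀ c d, P c d → G.IsChord c d → a ≤ c → d ≤ b → c = a ∧ d = b := by
  obtain ⟨a, b, hab⟩ := hP
  obtain ⟨⟨a, b⟩, ⟨h1, h2⟩, h3⟩ :=
    (measure fun p : V × V => (Set.Icc p.1 p.2).ncard).wf.has_min
      {p | P p.1 p.2 ∧ G.IsChord p.1 p.2} ⟨(a, b), hab⟩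
  refine ⟨a, b, h1, h2, fun c d hc hcd hac hdb => ?_⟩
  by_contra hne
  exact h3 (c, d) ⟨hc, hcd⟩ (hcd.ncard_Icc_lt hac hdb hne)

theorem exists_isMinChord_ncard_le_four [Finite V] [Nonempty V]
    (hnc : ∀ a b c d, G.Adj a b → G.Adj c d → ¬(a < c ∧ c < b ∧ b < d))
    (hdeg : ∀ v, 2 ≤ (G.neighborSet v).ncard) :
    ∃ a b, G.IsMinChord a b ∧
      ((G.neighborSet a).ncard ≤ 4 ∨ (G.neighborSet b).ncard ≤ 4) := by
  by_cases hall : ∀ a b, G.IsChord a b → G.IsMinChord a b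
  · obtain ⟨a, b, hab⟩ := exists_isChord hdeg
    exact ⟨a, b, hall a b hab, Or.inl (ncard_neighborSet_le_four (hall a) (hall · a))⟩
  · push Not at hall
    obtain ⟨a, b, hab, hnm⟩ := hall
    obtain ⟨a, b, hnm, hab, hmin⟩ :=
      IsChord.exists_minimal (fun a b => ¬ G.IsMinChord a b) ⟨a, b, hnm, hab⟩
    have hsmall : ∀ e, a < e → e < b → (G.neighborSet e).ncard ≤ 4 := by
      intro e hae heb
      refine ncard_neighborSet_le_four (fun y hy => ?_) (fun y hy => ?_)
      · by_contra hn
        have hyb : y ≤ b := le_of_not_gt fun h => hnc a b e y hab.1 hy.1 ⟨hae, heb, h⟩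
        exact hae.ne' (hmin e y hn hy hae.le hyb).1
      · by_contra hn
        have hay : a ≤ y := le_of_not_gt fun h => hnc y e a b hy.1 hab.1 ⟨h, hae, heb⟩
        exact heb.ne (hmin y e hn hy hay heb.le).2
    obtain ⟨c, d, hcd, hac, hdb, hne⟩ : ∃ c d, G.IsChord c d ∧ a ≤ c ∧ d ≤ b ∧
        ¬(c = a ∧ d = b) := by
      by_contra! h
      exact hnm ⟨hab, fun c d h1 h2 h3 => by grind⟩
    have hm : G.IsMinChord c d := by
      by_contra hn
      exact hne (hmin c d hn hcd hac hdb)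
    have hlt : c < d := by obtain ⟨-, z, h1, h2⟩ := hcd; exact h1.trans h2
    refine ⟨c, d, hm, ?_⟩
    rcases hac.lt_or_eq with h | rfl
    · exact Or.inl (hsmall c h (hlt.trans_le hdb))
    · exact Or.inr (hsmall d hlt (lt_of_le_of_ne hdb fun h => hne ⟨rfl, h⟩))

/-- Inside a minimal chord every vertex is joined exactly to its predecessor and successor. -/
theorem IsMinChord.exists_covBy [Finite V] {a b x : V} (h : G.IsMinChord a b)
    (hnc : ∀ a b c d, G.Adj a b → G.Adj c d → ¬(a < c ∧ c < b ∧ b < d))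
    (hdeg : 2 ≤ (G.neighborSet x).ncard) (hax : a < x) (hxb : x < b) :
    ∃ p q, a ≤ p ∧ p ⋖ x ∧ x ⋖ q ∧ q ≤ b ∧ ∀ w, G.Adj x w ↔ w = p ∨ w = q := by
  have hr : ∀ y, G.Adj x y → x < y → x ⋖ y ∧ y ≤ b := by
    intro y hy hxy
    have hyb : y ≤ b := le_of_not_gt fun hb => hnc a b x y h.1.1 hy ⟨hax, hxb, hb⟩
    exact ⟨⟨hxy, fun z h1 h2 => hax.ne' (h.2 x y ⟨hy, z, h1, h2⟩ hax.le hyb).1⟩, hyb⟩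
  have hl : ∀ y, G.Adj x y → y < x → y ⋖ x ∧ a ≤ y := by
    intro y hy hyx
    have hay : a ≤ y := le_of_not_gt fun ha => hnc y x a b hy.symm h.1.1 ⟨ha, hax, hxb⟩
    exact ⟨⟨hyx, fun z h1 h2 => hxb.ne (h.2 y x ⟨hy.symm, z, h1, h2⟩ hay hxb.le).2⟩, hay⟩
  have key : ∀ p q, G.Adj x p → G.Adj x q → p < q →
      ∃ p q, a ≤ p ∧ p ⋖ x ∧ x ⋖ q ∧ q ≤ b ∧ ∀ w, G.Adj x w ↔ w = p ∨ w = q := by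
    intro p q hp hq hpq
    have hpx : p < x := by
      by_contra hn
      have hxp := lt_of_le_of_ne (not_lt.1 hn) hp.ne
      exact (hr q hq (hxp.trans hpq)).1.2 hxp hpq
    have hxq : x < q := by
      by_contra hn
      have hqx := lt_of_le_of_ne (not_lt.1 hn) hq.ne'
      exact (hl p hp hpx).1.2 hpq hqx
    obtain ⟨hpx, hap⟩ := hl p hp hpx
    obtain ⟨hxq, hqb⟩ := hr q hq hxq
    refine ⟨p, q, hap, hpx, hxq, hqb, fun w => ⟨fun hw => ?_, by rintro (rfl | rfl) <;> assumption⟩⟩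
    rcases lt_or_gt_of_ne hw.ne with h1 | h1
    · exact Or.inr ((hr w hw h1).1.unique_right hxq)
    · exact Or.inl ((hl w hw h1).1.unique_left hpx)
  obtain ⟨p, hp, q, hq, hpq⟩ := (Set.one_lt_ncard).1 hdeg
  rcases lt_or_gt_of_ne hpq with h1 | h1
  · exact key p q hp hq h1
  · exact key q p hq hp h1

theorem exists_reducible_path [Finite V] [Nonempty V]
    (hnc : ∀ a b c d, G.Adj a b → G.Adj c d → ¬(a < c ∧ c < b ∧ b < d))
    (htri : ∀ a b c, G.Adj a b → G.Adj b c → ¬ G.Adj a c)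
    (hdeg : ∀ v, 2 ≤ (G.neighborSet v).ncard) :
    (∃ u x y v, (G.neighborSet u).ncard ≤ 4 ∧ G.Adj u v ∧
      (∀ w, G.Adj x w ↔ w = u ∨ w = y) ∧ ∀ w, G.Adj y w ↔ w = x ∨ w = v) ∨
    ∃ u x y z v, (G.neighborSet u).ncard ≤ 4 ∧ (∀ w, G.Adj x w ↔ w = u ∨ w = y) ∧
      (∀ w, G.Adj y w ↔ w = x ∨ w = z) ∧ ∀ w, G.Adj z w ↔ w = y ∨ w = v := by
  obtain ⟨a, b, hab, hsmall⟩ := exists_isMinChord_ncard_le_four hnc hdeg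
  obtain ⟨z, haz, hzb⟩ := hab.1.2
  obtain ⟨x, ⟨hax, hxb⟩, hxmin⟩ :=
    Set.exists_min_image (Set.Ioo a b) id (Set.toFinite _) ⟨z, haz, hzb⟩
  obtain ⟨p, y, hap, hpx, hxy, hyb, hx⟩ := hab.exists_covBy hnc (hdeg x) hax hxb
  obtain rfl : a = p := by
    by_contra hne
    exact (hxmin p ⟨lt_of_le_of_ne hap hne, hpx.1.trans hxb⟩).not_gt hpx.1
  have hyb : y < b := lt_of_le_of_ne hyb fun h =>
    htri a x y ((hx a).2 (Or.inl rfl)).symm ((hx y).2 (Or.inr rfl)) (h ▸ hab.1.1)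
  obtain ⟨x', z, -, hx'y, hyz, hzb, hy⟩ := hab.exists_covBy hnc (hdeg y) (hax.trans hxy.1) hyb
  obtain rfl := hx'y.unique_left hxy
  rcases hzb.eq_or_lt with rfl | hzb
  · left
    rcases hsmall with h | h
    · exact ⟨a, x', y, z, h, hab.1.1, hx, hy⟩
    · exact ⟨z, y, x', a, h, hab.1.1.symm, fun w => (hy w).trans or_comm,
        fun w => (hx w).trans or_comm⟩
  · right
    obtain ⟨y', t, -, hy'z, hzt, htb, hz⟩ :=
      hab.exists_covBy hnc (hdeg z) (hax.trans (hxy.1.trans hyz.1)) hzb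
    obtain rfl := hy'z.unique_left hyz
    by_cases ha : (G.neighborSet a).ncard ≤ 4
    · exact ⟨a, x', y', z, t, ha, hx, hy, hz⟩
    · refine ⟨t, z, y', x', a, ?_, fun w => (hz w).trans or_comm,
        fun w => (hy w).trans or_comm, fun w => (hx w).trans or_comm⟩
      rcases htb.eq_or_lt with rfl | htb
      · exact hsmall.resolve_left ha
      · obtain ⟨p, q, -, -, -, -, ht⟩ := hab.exists_covBy hnc (hdeg t)
          (hax.trans (hxy.1.trans (hyz.1.trans hzt.1))) htb
        have : G.neighborSet t = {p, q} := by ext w; simp [ht]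
        rw [this]
        exact (Set.ncard_insert_le _ _).trans (by simp)

end Structure

theorem exists_isPairColoring {V : Type*} [Finite V] [LinearOrder V] {k : ℕ} (G : SimpleGraph V)
    (hk : 7 ≤ k) (hnc : ∀ a b c d, G.Adj a b → G.Adj c d → ¬(a < c ∧ c < b ∧ b < d))
    (htri : ∀ a b c, G.Adj a b → G.Adj b c → ¬ G.Adj a c)
    (hdeg : ∀ v, (G.neighborSet v).ncard + 2 ≤ k) :
    ∃ b c : V → Fin k, G.IsPairColoring Set.univ Set.univ b c := by
  have : NeZero k := ⟨by omega⟩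
  induction hn : Nat.card V using Nat.strong_induction_on generalizing V with
  | _ n ih =>
  subst hn
  have hdel : ∀ X : Set V, X.Nonempty →
      (∀ x ∈ X, ∀ u ∉ X, ∀ w ∉ X, G.Adj x u → G.Adj x w → u = w) →
      ∃ b c : V → Fin k, G.IsPairColoring Xᶜ Xᶜ b c := by
    classical
    rintro X ⟨x, hx⟩ hX
    obtain ⟨b, c, h⟩ := ih (Nat.card ↥Xᶜ) (Finite.card_subtype_lt (x := x) (by simpa using hx))
      (G.induce Xᶜ) (fun a b c d => hnc a b c d) (fun a b c => htri a b c)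
      (fun v => le_trans (Nat.add_le_add_right (Set.ncard_le_ncard_of_injOn Subtype.val
        (fun w hw => hw) Subtype.val_injective.injOn) 2) (hdeg v)) rfl
    refine ⟨fun v => if hv : v ∈ Xᶜ then b ⟨v, hv⟩ else 0,
      fun v => if hv : v ∈ Xᶜ then c ⟨v, hv⟩ else 0, ?_, ?_, ?_⟩
    · intro u hu w hw huw hd
      simp only [hu, hw, dif_pos]
      refine h.sq_ne ⟨u, hu⟩ trivial ⟨w, hw⟩ trivial (by simpa using huw) ?_
      refine hd.imp id fun ⟨m, h1, h2⟩ => ?_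
      by_cases hm : m ∈ X
      · exact absurd (hX m hm u hu w hw h1.symm h2) huw
      · exact ⟨⟨m, hm⟩, h1, h2⟩
    · intro u hu w hw huw
      simp only [hu, hw, dif_pos]
      exact h.adj_ne ⟨u, hu⟩ trivial ⟨w, hw⟩ trivial huw
    · intro u hu w hw huw
      simp only [hu, hw, dif_pos]
      exact h.closed_ne ⟨u, hu⟩ trivial ⟨w, hw⟩ trivial (huw.imp Subtype.ext id)
  by_cases hsmall : ∃ x, (G.neighborSet x).ncard ≤ 1
  · obtain ⟨x, hx⟩ := hsmall
    obtain ⟨b, c, h⟩ := hdel {x} ⟨x, rfl⟩ (by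
      rw [Set.ncard_le_one] at hx
      rintro _ rfl u - w - hu hw
      exact hx u hu w hw)
    exact h.extend_vertex hk hdeg hx
  push Not at hsmall
  rcases isEmpty_or_nonempty V with hV | hV
  · exact ⟨fun _ => 0, fun _ => 0, fun u => isEmptyElim u, fun u => isEmptyElim u,
      fun u => isEmptyElim u⟩
  rcases exists_reducible_path hnc htri hsmall with
    ⟨u, x, y, v, hu, huv, hx, hy⟩ | ⟨u, x, y, z, v, hu, hx, hy, hz⟩
  · obtain ⟨b, c, h⟩ := hdel {x, y} ⟨x, by simp⟩ (by grind)
    exact h.extend_edge hk hdeg hu huv hx hy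
  · obtain ⟨b, c, h⟩ := hdel {x, y, z} ⟨x, by simp⟩ (by grind)
    exact h.extend_path hk hdeg hu hx hy hz

open Classical in
/-- A pair coloring of all of `G` gives a vi-simultaneous `(k, 1)`-coloring. -/
theorem IsPairColoring.exists_isViColoring {k : ℕ} {G : SimpleGraph V} {b c : V → Fin k}
    (h : G.IsPairColoring Set.univ Set.univ b c) :
    ∃ cV cI, G.IsViColoring k cV cI ∧ ∀ u, (G.secondIncColors cI u).ncard ≤ 1 := by
  let cI : V → Sym2 V → Fin k := fun v e => if hv : v ∈ e then b (Sym2.Mem.other hv) else b v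
  have hcI : ∀ v w, cI v s(v, w) = b w := by
    intro v w
    have hv : v ∈ s(v, w) := Sym2.mem_mk_left v w
    have : Sym2.Mem.other hv = w := Sym2.congr_right.1 (Sym2.other_spec hv)
    simp only [cI, hv, dif_pos, this]
  have hinc : ∀ {v e}, G.IsIncidence v e → ∃ w, G.Adj v w ∧ e = s(v, w) := by
    rintro v e ⟨he, hv⟩
    obtain ⟨w, rfl⟩ := hv
    exact ⟨w, he, rfl⟩
  refine ⟨c, cI, ⟨?_, ?_, ?_⟩, fun u => ?_⟩
  · exact fun u v huv => h.adj_ne u trivial v trivial huv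
  · intro u w f hf huf
    obtain ⟨x, hx, rfl⟩ := hinc hf
    rw [hcI]
    rcases Sym2.mem_iff.1 huf with rfl | rfl
    · exact h.closed_ne u trivial x trivial (Or.inr hx)
    · exact h.closed_ne u trivial u trivial (Or.inl rfl)
  · intro v e w f he hf hne hvw
    obtain ⟨x, hx, rfl⟩ := hinc he
    obtain ⟨y, hy, rfl⟩ := hinc hf
    rw [hcI, hcI]
    have hx' := hx.symm
    have hy' := hy.symm
    have hxy : x ≠ y ∧ (G.Adj x y ∨ ∃ m, G.Adj x m ∧ G.Adj m y) := by
      simp only [Sym2.eq_iff, ne_eq, Prod.mk.injEq] at hne hvw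
      have := hx.ne
      have := hy.ne
      grind
    exact h.sq_ne x trivial y trivial hxy.1 hxy.2
  · rw [Set.ncard_le_one]
    rintro _ ⟨v, -, rfl⟩ _ ⟨w, -, rfl⟩
    rw [Sym2.eq_swap, hcI, Sym2.eq_swap, hcI]

theorem IsViColoring.ncard_neighborSet_add_two_le [Finite V] {k : ℕ} {G : SimpleGraph V}
    {cV : V → Fin k} {cI : V → Sym2 V → Fin k} (h : G.IsViColoring k cV cI) {v w : V}
    (hvw : G.Adj v w) : (G.neighborSet v).ncard + 2 ≤ k := by
  have hl : ∀ {x}, G.Adj v x → G.IsIncidence v s(v, x) := fun hx => ⟨hx, Sym2.mem_mk_left _ _⟩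
  have hr : G.IsIncidence w s(v, w) := ⟨hvw, Sym2.mem_mk_right _ _⟩
  have hinj : Set.InjOn (fun x => cI v s(v, x)) (G.neighborSet v) := by
    intro x hx y hy hxy
    by_contra hne
    exact h.inc_ne (hl hx) (hl hy) (fun he => hne (Sym2.congr_right.1 (congrArg Prod.snd he)))
      (Or.inl rfl) hxy
  have h1 : cI w s(v, w) ∉ (fun x => cI v s(v, x)) '' G.neighborSet v := by
    rintro ⟨x, hx, hxw⟩
    exact h.inc_ne (hl hx) hr (by simp [hvw.ne]) (Or.inr (Or.inr (Or.inr rfl))) hxw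
  have h2 : cV v ∉ insert (cI w s(v, w)) ((fun x => cI v s(v, x)) '' G.neighborSet v) := by
    rintro (hv | ⟨x, hx, hxv⟩)
    · exact h.vertex_inc_ne hr (Sym2.mem_mk_left _ _) hv
    · exact h.vertex_inc_ne (hl hx) (Sym2.mem_mk_left _ _) hxv.symm
  have h3 := Set.ncard_le_card
    (insert (cV v) (insert (cI w s(v, w)) ((fun x => cI v s(v, x)) '' G.neighborSet v)))
  rwa [Set.ncard_insert_of_notMem h2, Set.ncard_insert_of_notMem h1, hinj.ncard_image,
    Nat.card_fin] at h3

theorem not_adj_of_four_le_egirth {G : SimpleGraph V} (hg : 4 ≤ G.egirth) {a b c : V}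
    (hab : G.Adj a b) (hbc : G.Adj b c) : ¬ G.Adj a c := by
  classical
  intro hac
  obtain ⟨u, p, hp, hlen⟩ :=
    is3Clique_iff_exists_cycle_length_three.1 ⟨{a, b, c}, is3Clique_triple_iff.2 ⟨hab, hac, hbc⟩⟩
  have := le_egirth.1 hg u p hp
  rw [hlen] at this
  exact absurd this (by decide)

end SimpleGraph

/-- If `G` is a finite 2-connected outerplanar graph with `Δ(G) ≥ 5` and girth `g(G) ≥ 4`,
then `χ_{vi,1}(G) = Δ(G) + 2`. -/
theorem chiViS_one_eq_of_twoConnected' [Fintype V] (G : SimpleGraph V) (hG : G.Outerplanar)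
    (h2 : G.TwoConnected) (hΔ : 5 ≤ G.maxDeg) (hg : 4 ≤ G.egirth) :
    G.chiViS 1 = G.maxDeg + 2 := by
  have hle : ∀ v, (G.neighborSet v).ncard ≤ G.maxDeg := fun v =>
    Finset.le_sup (f := fun v => (G.neighborSet v).ncard) (Finset.mem_univ v)
  have hne : (Finset.univ : Finset V).Nonempty :=
    Finset.card_pos.1 (by have := h2.1; rw [Finset.card_univ]; omega)
  obtain ⟨v, -, hv⟩ := Finset.exists_mem_eq_sup Finset.univ hne
    fun v => (G.neighborSet v).ncard
  change G.maxDeg = (G.neighborSet v).ncard at hv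
  obtain ⟨w, hw⟩ : (G.neighborSet v).Nonempty := Set.nonempty_of_ncard_ne_zero (by omega)
  obtain ⟨r, hr⟩ := hG
  obtain ⟨b, c, h⟩ := G.exists_isPairColoring (k := G.maxDeg + 2) (by omega) hr
    (fun _ _ _ => not_adj_of_four_le_egirth hg) (fun v => Nat.add_le_add_right (hle v) 2)
  refine le_antisymm (Nat.sInf_le h.exists_isViColoring) ?_
  refine le_csInf ⟨_, h.exists_isViColoring⟩ ?_
  rintro k ⟨cV, cI, hc, -⟩
  rw [hv]
  exact hc.ncard_neighborSet_add_two_le hw
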